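/- arXiv:math/9806161 — 3 statements merged into one kernel-verified Lean document; each statement's English description precedes it below -/
import Mathlib

section
/- Let n be a positive even integer and let M₁, …, Mₙ be arbitrary N×N complex matrices. Then the full antisymmetrization of the trace of their product vanishes: Σ_{σ ∈ Sₙ} sgn(σ) · tr(M_{σ(1)} M_{σ(2)} ⋯ M_{σ(n)}) = 0. (This is the algebraic content of the vanishing of the differential form Tr(V⁻¹dV)ⁿ for even n.) -/
theorem trace_rot_aux (N m : ℕ) (f : Fin (m+1) → Matrix (Fin N) (Fin N) ℂ) :
    Matrix.trace (((List.finRange (m+1)).map fun i => f (finRotate (m+1) i)).prod) =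
      Matrix.trace (((List.finRange (m+1)).map f).prod) := by
  rw [← List.ofFn_eq_map, ← List.ofFn_eq_map, List.ofFn_succ', List.ofFn_succ]
  rw [List.concat_eq_append, List.prod_append, List.prod_cons, Matrix.trace_mul_comm]
  simp [Fin.coeSucc_eq_succ]

/-- for `n` a positive even integer, the full antisymmetrization of the
trace of a product of `n` matrices vanishes. -/
theorem antisymmetrized_trace_prod_eq_zero_of_even
    (N n : ℕ) (hn : 0 < n) (hev : Even n)
    (M : Fin n → Matrix (Fin N) (Fin N) ℂ) :
    ∑ σ : Equiv.Perm (Fin n),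
      ((Equiv.Perm.sign σ : ℤ) : ℂ) *
        Matrix.trace (((List.finRange n).map fun i => M (σ i)).prod) = 0 := by
  obtain ⟨m, rfl⟩ : ∃ m, n = m + 1 := ⟨n - 1, by omega⟩
  have hodd : Odd m := by
    rcases Nat.even_or_odd m with h | h
    · exact absurd hev (by simpa [Nat.even_add_one] using h)
    · exact h
  have hs : Equiv.Perm.sign (finRotate (m+1)) = -1 := by
    rw [sign_finRotate, Nat.add_sub_cancel, hodd.neg_one_pow]
  rw [← self_eq_neg, ← Finset.sum_neg_distrib]
  refine (Fintype.sum_equiv (Equiv.mulRight (finRotate (m+1))) _ _ fun σ => ?_).symm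
  have h := trace_rot_aux N m (fun i => M (σ i))
  simp only [Equiv.coe_mulRight, Equiv.Perm.sign_mul, hs, Equiv.Perm.coe_mul, Function.comp_apply]
  rw [h]
  simp
end

section
/- Let F be an N×N complex matrix with F² = F, let n be a positive odd integer, and let A₁, …, Aₙ be N×N complex matrices each satisfying Aᵢ = F·Aᵢ + Aᵢ·F. Then tr(F · A₁ A₂ ⋯ Aₙ) = 0. (This is the algebraic content of the vanishing of the form Tr F(dF)ⁿ for odd n, since each derivative dF of an idempotent family F satisfies dF = F·dF + dF·F.) -/
theorem aux_list_comm {R : Type*} [Ring R] (F : R) (l : List R)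
    (h : ∀ a ∈ l, a = F * a + a * F) :
    (Even l.length → F * l.prod = l.prod * F) ∧
    (Odd l.length → F * l.prod = l.prod - l.prod * F) := by
  induction l with
  | nil => simp
  | cons a l ih =>
    obtain ⟨h1, h2⟩ := ih (fun b hb => h b (List.mem_cons_of_mem _ hb))
    have ha : F * a = a - a * F := eq_sub_of_add_eq (h a List.mem_cons_self).symm
    have key : F * (a * l.prod) = a * l.prod - a * (F * l.prod) := by
      rw [← mul_assoc, ha, sub_mul, mul_assoc]
    rw [List.length_cons, List.prod_cons, key]
    constructor
    · intro he
      have ho : Odd l.length := by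
        rw [Nat.even_add_one] at he
        exact Nat.not_even_iff_odd.mp he
      rw [h2 ho, mul_sub, mul_assoc]
      abel
    · intro ho
      have he : Even l.length := by
        rw [Nat.odd_add_one] at ho
        exact Nat.not_odd_iff_even.mp ho
      rw [h1 he, mul_assoc]

/-- if `F² = F`, `n` is a positive odd integer and each `Aᵢ` satisfies
`Aᵢ = F Aᵢ + Aᵢ F`, then `tr(F A₁ ⋯ Aₙ) = 0`. -/
theorem trace_idem_mul_odd_prod_eq_zero
    (N n : ℕ) (hn : 0 < n) (hodd : Odd n)
    (F : Matrix (Fin N) (Fin N) ℂ) (hF : F * F = F)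
    (A : Fin n → Matrix (Fin N) (Fin N) ℂ)
    (hA : ∀ i, A i = F * A i + A i * F) :
    Matrix.trace (F * ((List.finRange n).map fun i => A i).prod) = 0 := by
  have h := (aux_list_comm F ((List.finRange n).map fun i => A i) (by
    intro a ha
    obtain ⟨i, -, rfl⟩ := List.mem_map.mp ha
    exact hA i)).2 (by simpa using hodd)
  generalize ((List.finRange n).map fun i => A i).prod = P at h ⊢
  have h3 : F * P = F * P - F * (P * F) := by
    conv_lhs => rw [← hF, mul_assoc, h, mul_sub]
  have h4 : Matrix.trace (F * (P * F)) = Matrix.trace (F * P) := by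
    rw [Matrix.trace_mul_comm, mul_assoc, hF, Matrix.trace_mul_comm]
  rw [h3, Matrix.trace_sub, h4, sub_self]
end

section
/- Let F be an N×N complex matrix with F² = F, let m be a positive odd integer, and let A₁, …, Aₘ be N×N complex matrices each satisfying Aᵢ = F·Aᵢ + Aᵢ·F. Then tr(A₁ A₂ ⋯ Aₘ) = 0. (This is the algebraic content of the closedness d Tr F(dF)ⁿ = Tr(dF)^{n+1} = 0 for even n.) -/
theorem aux_list_anticomm {R : Type*} [Ring R] (G : R) (l : List R)
    (h : ∀ a ∈ l, G * a = -(a * G)) :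
    G * l.prod = (-1) ^ l.length * (l.prod * G) := by
  induction l with
  | nil => simp
  | cons a l ih =>
    have h1 := h a (by simp)
    have h2 := ih (fun b hb => h b (by simp [hb]))
    have hc : a * (-1) ^ l.length = (-1) ^ l.length * a :=
      ((Commute.neg_one_right a).pow_right _).eq
    rw [List.prod_cons, List.length_cons, ← mul_assoc, h1, neg_mul, mul_assoc, h2, ← mul_assoc, hc,
      pow_succ]
    simp [mul_assoc]

/-- if `F² = F`, `m` is a positive odd integer and each `Aᵢ` satisfies
`Aᵢ = F Aᵢ + Aᵢ F`, then `tr(A₁ ⋯ Aₘ) = 0`. -/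
theorem trace_odd_prod_eq_zero
    (N m : ℕ) (hm : 0 < m) (hodd : Odd m)
    (F : Matrix (Fin N) (Fin N) ℂ) (hF : F * F = F)
    (A : Fin m → Matrix (Fin N) (Fin N) ℂ)
    (hA : ∀ i, A i = F * A i + A i * F) :
    Matrix.trace (((List.finRange m).map fun i => A i).prod) = 0 := by
  have hG : (1 - F - F) * (1 - F - F) = 1 := by
    simp only [sub_mul, mul_sub, hF, one_mul, mul_one]
    abel
  have hP := aux_list_anticomm (1 - F - F) ((List.finRange m).map fun i => A i) (by
    intro a ha
    obtain ⟨i, -, rfl⟩ := List.mem_map.1 ha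
    have h := hA i
    have h0 : A i - F * A i - A i * F = 0 := by
      rw [sub_sub, ← h, sub_self]
    rw [eq_neg_iff_add_eq_zero]
    calc (1 - F - F) * A i + A i * (1 - F - F)
        = (A i - F * A i - A i * F) + (A i - F * A i - A i * F) := by
          simp only [sub_mul, mul_sub, one_mul, mul_one]
          abel
      _ = 0 := by rw [h0, add_zero])
  rw [List.length_map, List.length_finRange, hodd.neg_one_pow] at hP
  generalize ((List.finRange m).map fun i => A i).prod = P at hP ⊢
  generalize 1 - F - F = G at hG hP
  have h1 : Matrix.trace P = - Matrix.trace P := by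
    calc Matrix.trace P = Matrix.trace (G * (G * P)) := by rw [← mul_assoc, hG, one_mul]
      _ = - Matrix.trace (G * (P * G)) := by
          rw [hP, neg_one_mul, mul_neg, Matrix.trace_neg]
      _ = - Matrix.trace P := by
          rw [Matrix.trace_mul_comm, mul_assoc, hG, mul_one]
  exact self_eq_neg.1 h1
end
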